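/- Let K be a field of characteristic zero containing a primitive 5th root of unity zeta; set phi = 1 + zeta + zeta^4 and kappa = zeta^4 - zeta. Then the set of polynomials f in K[a,b] satisfying both f(zeta^2*a, zeta^3*b) = f(a,b) and f((phi*a + b)/kappa, (a - phi*b)/kappa) = f(a,b) is exactly the K-subalgebra of K[a,b] generated by D, c4 and c6. -/

import Mathlib

open MvPolynomial

/-- The binary form `D = a*b*(a^10 - 11 a^5 b^5 - b^10)` in `K[a,b]`. -/
noncomputable def Dpoly (K : Type*) [CommRing K] : MvPolynomial (Fin 2) K :=
  X 0 * X 1 * (X 0 ^ 10 - 11 * X 0 ^ 5 * X 1 ^ 5 - X 1 ^ 10)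

/-- The binary form `c4` in `K[a,b]`. -/
noncomputable def c4poly (K : Type*) [CommRing K] : MvPolynomial (Fin 2) K :=
  X 0 ^ 20 + 228 * X 0 ^ 15 * X 1 ^ 5 + 494 * X 0 ^ 10 * X 1 ^ 10
    - 228 * X 0 ^ 5 * X 1 ^ 15 + X 1 ^ 20

/-- The binary form `c6` in `K[a,b]`. -/
noncomputable def c6poly (K : Type*) [CommRing K] : MvPolynomial (Fin 2) K :=
  -(X 0 ^ 30) + 522 * X 0 ^ 25 * X 1 ^ 5 + 10005 * X 0 ^ 20 * X 1 ^ 10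
    + 10005 * X 0 ^ 10 * X 1 ^ 20 - 522 * X 0 ^ 5 * X 1 ^ 25 - X 1 ^ 30

lemma mulred {R : Type*} [CommRing R] {p x y x0 x1 y0 y1 : R} (z0 z1 : R) (hp : p ^ 2 = p + 1)
    (hx : x = x0 + p * x1) (hy : y = y0 + p * y1)
    (h0 : z0 = x0 * y0 + x1 * y1) (h1 : z1 = x0 * y1 + x1 * y0 + x1 * y1) :
    x * y = z0 + p * z1 := by
  subst hx hy h0 h1
  linear_combination (x1 * y1) * hp

set_option maxHeartbeats 4000000 in
lemma forms_transform {R : Type*} [CommRing R] (p a b u v : R) (hp : p ^ 2 = p + 1)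
    (hu : u = p * a + b) (hv : v = a - p * b) :
    u * v * (u ^ 10 - 11 * u ^ 5 * v ^ 5 - v ^ 10)
      = (p + 2) ^ 6 * (a * b * (a ^ 10 - 11 * a ^ 5 * b ^ 5 - b ^ 10)) ∧
    u ^ 20 + 228 * u ^ 15 * v ^ 5 + 494 * u ^ 10 * v ^ 10 - 228 * u ^ 5 * v ^ 15 + v ^ 20
      = (p + 2) ^ 10 * (a ^ 20 + 228 * a ^ 15 * b ^ 5 + 494 * a ^ 10 * b ^ 10
        - 228 * a ^ 5 * b ^ 15 + b ^ 20) ∧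
    -(u ^ 30) + 522 * u ^ 25 * v ^ 5 + 10005 * u ^ 20 * v ^ 10
      + 10005 * u ^ 10 * v ^ 20 - 522 * u ^ 5 * v ^ 25 - v ^ 30
      = -(p + 2) ^ 15 * (-(a ^ 30) + 522 * a ^ 25 * b ^ 5 + 10005 * a ^ 20 * b ^ 10
        + 10005 * a ^ 10 * b ^ 20 - 522 * a ^ 5 * b ^ 25 - b ^ 30) := by
  have e1 : u = b + p * a := by rw [hu]; ring
  have f1 : v = a + p * (-b) := by rw [hv]; ring
  have w1 : p + 2 = 2 + p * 1 := by ring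
  have e2 := mulred ((1)*a^2*b^0 + (1)*a^0*b^2) ((1)*a^2*b^0 + (2)*a^1*b^1) hp e1 e1 (by ring) (by ring)
  have e4 := mulred ((2)*a^4*b^0 + (4)*a^3*b^1 + (6)*a^2*b^2 + (1)*a^0*b^4) ((3)*a^4*b^0 + (8)*a^3*b^1 + (6)*a^2*b^2 + (4)*a^1*b^3) hp e2 e2 (by ring) (by ring)
  have e5 := mulred ((3)*a^5*b^0 + (10)*a^4*b^1 + (10)*a^3*b^2 + (10)*a^2*b^3 + (1)*a^0*b^5) ((5)*a^5*b^0 + (15)*a^4*b^1 + (20)*a^3*b^2 + (10)*a^2*b^3 + (5)*a^1*b^4) hp e4 e1 (by ring) (by ring)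
  have f2 := mulred ((1)*a^2*b^0 + (1)*a^0*b^2) ((-2)*a^1*b^1 + (1)*a^0*b^2) hp f1 f1 (by ring) (by ring)
  have f4 := mulred ((1)*a^4*b^0 + (6)*a^2*b^2 + (-4)*a^1*b^3 + (2)*a^0*b^4) ((-4)*a^3*b^1 + (6)*a^2*b^2 + (-8)*a^1*b^3 + (3)*a^0*b^4) hp f2 f2 (by ring) (by ring)
  have f5 := mulred ((1)*a^5*b^0 + (10)*a^3*b^2 + (-10)*a^2*b^3 + (10)*a^1*b^4 + (-3)*a^0*b^5) ((-5)*a^4*b^1 + (10)*a^3*b^2 + (-20)*a^2*b^3 + (15)*a^1*b^4 + (-5)*a^0*b^5) hp f4 f1 (by ring) (by ring)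
  have g := mulred (0) ((1)*a^2*b^0 + (-1)*a^1*b^1 + (-1)*a^0*b^2) hp e1 f1 (by ring) (by ring)
  have hX := mulred ((34)*a^10*b^0 + (210)*a^9*b^1 + (585)*a^8*b^2 + (960)*a^7*b^3 + (1050)*a^6*b^4 + (756)*a^5*b^5 + (420)*a^4*b^6 + (120)*a^3*b^7 + (45)*a^2*b^8 + (1)*a^0*b^10) ((55)*a^10*b^0 + (340)*a^9*b^1 + (945)*a^8*b^2 + (1560)*a^7*b^3 + (1680)*a^6*b^4 + (1260)*a^5*b^5 + (630)*a^4*b^6 + (240)*a^3*b^7 + (45)*a^2*b^8 + (10)*a^1*b^9) hp e5 e5 (by ring) (by ring)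
  have hY := mulred ((3)*a^10*b^0 + (-15)*a^9*b^1 + (15)*a^8*b^2 + (30)*a^7*b^3 + (-45)*a^6*b^4 + (-33)*a^5*b^5 + (45)*a^4*b^6 + (30)*a^3*b^7 + (-15)*a^2*b^8 + (-15)*a^1*b^9 + (-3)*a^0*b^10) ((5)*a^10*b^0 + (-25)*a^9*b^1 + (25)*a^8*b^2 + (50)*a^7*b^3 + (-75)*a^6*b^4 + (-55)*a^5*b^5 + (75)*a^4*b^6 + (50)*a^3*b^7 + (-25)*a^2*b^8 + (-25)*a^1*b^9 + (-5)*a^0*b^10) hp e5 f5 (by ring) (by ring)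
  have hZ := mulred ((1)*a^10*b^0 + (45)*a^8*b^2 + (-120)*a^7*b^3 + (420)*a^6*b^4 + (-756)*a^5*b^5 + (1050)*a^4*b^6 + (-960)*a^3*b^7 + (585)*a^2*b^8 + (-210)*a^1*b^9 + (34)*a^0*b^10) ((-10)*a^9*b^1 + (45)*a^8*b^2 + (-240)*a^7*b^3 + (630)*a^6*b^4 + (-1260)*a^5*b^5 + (1680)*a^4*b^6 + (-1560)*a^3*b^7 + (945)*a^2*b^8 + (-340)*a^1*b^9 + (55)*a^0*b^10) hp f5 f5 (by ring) (by ring)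
  have hXX := mulred ((4181)*a^20*b^0 + (51680)*a^19*b^1 + (303430)*a^18*b^2 + (1125180)*a^17*b^3 + (2955450)*a^16*b^4 + (5845008)*a^15*b^5 + (9031080)*a^14*b^6 + (11162880)*a^13*b^7 + (11211330)*a^12*b^8 + (9237800)*a^11*b^9 + (6281704)*a^10*b^10 + (3527160)*a^9*b^11 + (1637610)*a^8*b^12 + (620160)*a^7*b^13 + (193800)*a^6*b^14 + (46512)*a^5*b^15 + (9690)*a^4*b^16 + (1140)*a^3*b^17 + (190)*a^2*b^18 + (1)*a^0*b^20) ((6765)*a^20*b^0 + (83620)*a^19*b^1 + (490960)*a^18*b^2 + (1820580)*a^17*b^3 + (4782015)*a^16*b^4 + (9457440)*a^15*b^5 + (14612520)*a^14*b^6 + (18062160)*a^13*b^7 + (18139680)*a^12*b^8 + (14948440)*a^11*b^9 + (10161580)*a^10*b^10 + (5710640)*a^9*b^11 + (2645370)*a^8*b^12 + (1007760)*a^7*b^13 + (310080)*a^6*b^14 + (77520)*a^5*b^15 + (14535)*a^4*b^16 + (2280)*a^3*b^17 + (190)*a^2*b^18 + (20)*a^1*b^19) hp hX hX (by ring) (by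 ring)
  have hZZ := mulred ((1)*a^20*b^0 + (190)*a^18*b^2 + (-1140)*a^17*b^3 + (9690)*a^16*b^4 + (-46512)*a^15*b^5 + (193800)*a^14*b^6 + (-620160)*a^13*b^7 + (1637610)*a^12*b^8 + (-3527160)*a^11*b^9 + (6281704)*a^10*b^10 + (-9237800)*a^9*b^11 + (11211330)*a^8*b^12 + (-11162880)*a^7*b^13 + (9031080)*a^6*b^14 + (-5845008)*a^5*b^15 + (2955450)*a^4*b^16 + (-1125180)*a^3*b^17 + (303430)*a^2*b^18 + (-51680)*a^1*b^19 + (4181)*a^0*b^20) ((-20)*a^19*b^1 + (190)*a^18*b^2 + (-2280)*a^17*b^3 + (14535)*a^16*b^4 + (-77520)*a^15*b^5 + (310080)*a^14*b^6 + (-1007760)*a^13*b^7 + (2645370)*a^12*b^8 + (-5710640)*a^11*b^9 + (10161580)*a^10*b^10 + (-14948440)*a^9*b^11 + (18139680)*a^8*b^12 + (-18062160)*a^7*b^13 + (14612520)*a^6*b^14 + (-9457440)*a^5*b^15 + (4782015)*a^4*b^16 + (-1820580)*a^3*b^17 + (490960)*a^2*b^18 + (-83620)*a^1*b^19 + (6765)*a^0*b^20)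 hp hZ hZ (by ring) (by ring)
  have hG : (1)*(u * u * (u * u) * u * (u * u * (u * u) * u)) + (-11)*(u * u * (u * u) * u * (v * v * (v * v) * v)) + (-1)*(v * v * (v * v) * v * (v * v * (v * v) * v)) = ((375)*a^9*b^1 + (375)*a^8*b^2 + (750)*a^7*b^3 + (1125)*a^6*b^4 + (1875)*a^5*b^5 + (-1125)*a^4*b^6 + (750)*a^3*b^7 + (-375)*a^2*b^8 + (375)*a^1*b^9) + p * ((625)*a^9*b^1 + (625)*a^8*b^2 + (1250)*a^7*b^3 + (1875)*a^6*b^4 + (3125)*a^5*b^5 + (-1875)*a^4*b^6 + (1250)*a^3*b^7 + (-625)*a^2*b^8 + (625)*a^1*b^9) := by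
    linear_combination (1)*hX + (-11)*hY + (-1)*hZ
  have hU : (-1)*(u * u * (u * u) * u * (u * u * (u * u) * u)) + (522)*(u * u * (u * u) * u * (v * v * (v * v) * v)) + (10005)*(v * v * (v * v) * v * (v * v * (v * v) * v)) = ((11537)*a^10*b^0 + (-8040)*a^9*b^1 + (457470)*a^8*b^2 + (-1185900)*a^7*b^3 + (4177560)*a^6*b^4 + (-7581762)*a^5*b^5 + (10528320)*a^4*b^6 + (-9589260)*a^3*b^7 + (5845050)*a^2*b^8 + (-2108880)*a^1*b^9 + (338603)*a^0*b^10) + p * ((2555)*a^10*b^0 + (-113440)*a^9*b^1 + (462330)*a^8*b^2 + (-2376660)*a^7*b^3 + (6262320)*a^6*b^4 + (-12636270)*a^5*b^5 + (16846920)*a^4*b^6 + (-15581940)*a^3*b^7 + (9441630)*a^2*b^8 + (-3414760)*a^1*b^9 + (547665)*a^0*b^10) := by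
    linear_combination (-1)*hX + (522)*hY + (10005)*hZ
  have hV : (10005)*(u * u * (u * u) * u * (u * u * (u * u) * u)) + (-522)*(u * u * (u * u) * u * (v * v * (v * v) * v)) + (-1)*(v * v * (v * v) * v * (v * v * (v * v) * v)) = ((338603)*a^10*b^0 + (2108880)*a^9*b^1 + (5845050)*a^8*b^2 + (9589260)*a^7*b^3 + (10528320)*a^6*b^4 + (7581762)*a^5*b^5 + (4177560)*a^4*b^6 + (1185900)*a^3*b^7 + (457470)*a^2*b^8 + (8040)*a^1*b^9 + (11537)*a^0*b^10) + p * ((547665)*a^10*b^0 + (3414760)*a^9*b^1 + (9441630)*a^8*b^2 + (15581940)*a^7*b^3 + (16846920)*a^6*b^4 + (12636270)*a^5*b^5 + (6262320)*a^4*b^6 + (2376660)*a^3*b^7 + (462330)*a^2*b^8 + (113440)*a^1*b^9 + (2555)*a^0*b^10) := by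
    linear_combination (10005)*hX + (-522)*hY + (-1)*hZ
  have hS : (1)*(u * u * (u * u) * u * (u * u * (u * u) * u)) + (228)*(u * u * (u * u) * u * (v * v * (v * v) * v)) + (494)*(v * v * (v * v) * v * (v * v * (v * v) * v)) = ((1212)*a^10*b^0 + (-3210)*a^9*b^1 + (26235)*a^8*b^2 + (-51480)*a^7*b^3 + (198270)*a^6*b^4 + (-380232)*a^5*b^5 + (529380)*a^4*b^6 + (-467280)*a^3*b^7 + (285615)*a^2*b^8 + (-107160)*a^1*b^9 + (16113)*a^0*b^10) + p * ((1195)*a^10*b^0 + (-10300)*a^9*b^1 + (28875)*a^8*b^2 + (-105600)*a^7*b^3 + (295800)*a^6*b^4 + (-633720)*a^5*b^5 + (847650)*a^4*b^6 + (-759000)*a^3*b^7 + (461175)*a^2*b^8 + (-173650)*a^1*b^9 + (26030)*a^0*b^10) := by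
    linear_combination (1)*hX + (228)*hY + (494)*hZ
  have hT : (-228)*(u * u * (u * u) * u * (v * v * (v * v) * v)) + (1)*(v * v * (v * v) * v * (v * v * (v * v) * v)) = ((-683)*a^10*b^0 + (3420)*a^9*b^1 + (-3375)*a^8*b^2 + (-6960)*a^7*b^3 + (10680)*a^6*b^4 + (6768)*a^5*b^5 + (-9210)*a^4*b^6 + (-7800)*a^3*b^7 + (4005)*a^2*b^8 + (3210)*a^1*b^9 + (718)*a^0*b^10) + p * ((-1140)*a^10*b^0 + (5690)*a^9*b^1 + (-5655)*a^8*b^2 + (-11640)*a^7*b^3 + (17730)*a^6*b^4 + (11280)*a^5*b^5 + (-15420)*a^4*b^6 + (-12960)*a^3*b^7 + (6645)*a^2*b^8 + (5360)*a^1*b^9 + (1195)*a^0*b^10) := by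
    linear_combination (-228)*hY + (1)*hZ
  have hD := mulred ((625)*a^11*b^1 + (-6875)*a^6*b^6 + (-625)*a^1*b^11) ((1000)*a^11*b^1 + (-11000)*a^6*b^6 + (-1000)*a^1*b^11) hp g hG (by ring) (by ring)
  have hSX := mulred ((106933)*a^20*b^0 + (-14820)*a^19*b^1 + (142310)*a^18*b^2 + (-815100)*a^17*b^3 + (3060330)*a^16*b^4 + (16496484)*a^15*b^5 + (12582180)*a^14*b^6 + (-10426440)*a^13*b^7 + (-4408950)*a^12*b^8 + (23548980)*a^11*b^9 + (25143612)*a^10*b^10 + (10616060)*a^9*b^11 + (5164770)*a^8*b^12 + (-1356600)*a^7*b^13 + (-11070540)*a^6*b^14 + (-11558004)*a^5*b^15 + (-4823910)*a^4*b^16 + (-311220)*a^3*b^17 + (445550)*a^2*b^18 + (153140)*a^1*b^19 + (16113)*a^0*b^20) ((173015)*a^20*b^0 + (-23920)*a^19*b^1 + (230090)*a^18*b^2 + (-1318980)*a^17*b^3 + (4953585)*a^16*b^4 + (26687400)*a^15*b^5 + (20362680)*a^14*b^6 + (-16870860)*a^13*b^7 + (-7135830)*a^12*b^8 + (38107160)*a^11*b^9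 + (40673490)*a^10*b^10 + (17186260)*a^9*b^11 + (8358480)*a^8*b^12 + (-2199060)*a^7*b^13 + (-17917380)*a^6*b^14 + (-18694860)*a^5*b^15 + (-7806435)*a^4*b^16 + (-503880)*a^3*b^17 + (720860)*a^2*b^18 + (247780)*a^1*b^19 + (26030)*a^0*b^20) hp hX hS (by ring) (by ring)
  have hTZ := mulred ((-683)*a^20*b^0 + (14820)*a^19*b^1 + (-142310)*a^18*b^2 + (815100)*a^17*b^3 + (-3060330)*a^16*b^4 + (7728516)*a^15*b^5 + (-12582180)*a^14*b^6 + (10426440)*a^13*b^7 + (4408950)*a^12*b^8 + (-23548980)*a^11*b^9 + (27343888)*a^10*b^10 + (-10616060)*a^9*b^11 + (-5164770)*a^8*b^12 + (1356600)*a^7*b^13 + (11070540)*a^6*b^14 + (-12666996)*a^5*b^15 + (4823910)*a^4*b^16 + (311220)*a^3*b^17 + (-445550)*a^2*b^18 + (-153140)*a^1*b^19 + (90137)*a^0*b^20) ((-1140)*a^20*b^0 + (23920)*a^19*b^1 + (-230090)*a^18*b^2 + (1318980)*a^17*b^3 + (-4953585)*a^16*b^4 + (12500100)*a^15*b^5 +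 (-20362680)*a^14*b^6 + (16870860)*a^13*b^7 + (7135830)*a^12*b^8 + (-38107160)*a^11*b^9 + (44232760)*a^10*b^10 + (-17186260)*a^9*b^11 + (-8358480)*a^8*b^12 + (2199060)*a^7*b^13 + (17917380)*a^6*b^14 + (-20492640)*a^5*b^15 + (7806435)*a^4*b^16 + (503880)*a^3*b^17 + (-720860)*a^2*b^18 + (-247780)*a^1*b^19 + (145845)*a^0*b^20) hp hZ hT (by ring) (by ring)
  have hUX := mulred ((65520772)*a^30*b^0 + (8844420)*a^29*b^1 + (-105940770)*a^28*b^2 + (764435360)*a^27*b^3 + (-3654956565)*a^26*b^4 + (-22505981976)*a^25*b^5 + (-25007597550)*a^24*b^6 + (25425784800)*a^23*b^7 + (27949667850)*a^22*b^8 + (-158381451150)*a^21*b^9 + (-368012074080)*a^20*b^10 + (-266747707200)*a^19*b^11 + (48732754200)*a^18*b^12 + (133298415900)*a^17*b^13 + (-54824348475)*a^16*b^14 + (-116958610080)*a^15*b^15 + (54824348475)*a^14*b^16 + (133298415900)*a^13*b^17 + (-48732754200)*a^12*b^18 + (-266747707200)*a^11*b^19 + (-290910972795)*a^10*b^20 +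 (-158381451150)*a^9*b^21 + (-27949667850)*a^8*b^22 + (25425784800)*a^7*b^23 + (25007597550)*a^6*b^24 + (11872611774)*a^5*b^25 + (3654956565)*a^4*b^26 + (764435360)*a^3*b^27 + (105940770)*a^2*b^28 + (8844420)*a^1*b^29 + (338603)*a^0*b^30) ((106014835)*a^30*b^0 + (14310600)*a^29*b^1 + (-171416100)*a^28*b^2 + (1236884800)*a^27*b^3 + (-5913855450)*a^26*b^4 + (-36415406430)*a^25*b^5 + (-40463221500)*a^24*b^6 + (41139864000)*a^23*b^7 + (45223600500)*a^22*b^8 + (-256267069500)*a^21*b^9 + (-595455128775)*a^20*b^10 + (-431607696000)*a^19*b^11 + (78851406000)*a^18*b^12 + (215681787000)*a^17*b^13 + (-88707831750)*a^16*b^14 + (-189243374400)*a^15*b^15 + (88707831750)*a^14*b^16 + (215681787000)*a^13*b^17 + (-78851406000)*a^12*b^18 + (-431607696000)*a^11*b^19 + (-470702683725)*a^10*b^20 + (-256267069500)*a^9*b^21 + (-45223600500)*a^8*b^22 + (41139864000)*a^7*b^23 + (40463221500)*a^6*b^24 + (19210218570)*a^5*b^25 + (5913855450)*a^4*b^26 +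 (1236884800)*a^3*b^27 + (171416100)*a^2*b^28 + (14310600)*a^1*b^29 + (547665)*a^0*b^30) hp hXX hU (by ring) (by ring)
  have hVX := mulred ((338603)*a^30*b^0 + (-8844420)*a^29*b^1 + (105940770)*a^28*b^2 + (-764435360)*a^27*b^3 + (3654956565)*a^26*b^4 + (-11872611774)*a^25*b^5 + (25007597550)*a^24*b^6 + (-25425784800)*a^23*b^7 + (-27949667850)*a^22*b^8 + (158381451150)*a^21*b^9 + (-290910972795)*a^20*b^10 + (266747707200)*a^19*b^11 + (-48732754200)*a^18*b^12 + (-133298415900)*a^17*b^13 + (54824348475)*a^16*b^14 + (116958610080)*a^15*b^15 + (-54824348475)*a^14*b^16 + (-133298415900)*a^13*b^17 + (48732754200)*a^12*b^18 + (266747707200)*a^11*b^19 + (-368012074080)*a^10*b^20 + (158381451150)*a^9*b^21 + (27949667850)*a^8*b^22 + (-25425784800)*a^7*b^23 + (-25007597550)*a^6*b^24 + (22505981976)*a^5*b^25 + (-3654956565)*a^4*b^26 + (-764435360)*a^3*b^27 + (-105940770)*a^2*b^28 + (-8844420)*a^1*b^29 + (65520772)*a^0*b^30) ((547665)*a^30*b^0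 + (-14310600)*a^29*b^1 + (171416100)*a^28*b^2 + (-1236884800)*a^27*b^3 + (5913855450)*a^26*b^4 + (-19210218570)*a^25*b^5 + (40463221500)*a^24*b^6 + (-41139864000)*a^23*b^7 + (-45223600500)*a^22*b^8 + (256267069500)*a^21*b^9 + (-470702683725)*a^20*b^10 + (431607696000)*a^19*b^11 + (-78851406000)*a^18*b^12 + (-215681787000)*a^17*b^13 + (88707831750)*a^16*b^14 + (189243374400)*a^15*b^15 + (-88707831750)*a^14*b^16 + (-215681787000)*a^13*b^17 + (78851406000)*a^12*b^18 + (431607696000)*a^11*b^19 + (-595455128775)*a^10*b^20 + (256267069500)*a^9*b^21 + (45223600500)*a^8*b^22 + (-41139864000)*a^7*b^23 + (-40463221500)*a^6*b^24 + (36415406430)*a^5*b^25 + (-5913855450)*a^4*b^26 + (-1236884800)*a^3*b^27 + (-171416100)*a^2*b^28 + (-14310600)*a^1*b^29 + (106014835)*a^0*b^30) hp hZZ hV (by ring) (by ring)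
  have w6 : (p + 2) ^ 6 = 625 + p * 1000 := by
    have q2 : (p + 2) ^ 2 = 5 + p * 5 := by linear_combination hp
    have q4 : ((p + 2) ^ 2) ^ 2 = 50 + p * 75 := by rw [q2]; linear_combination 25 * hp
    calc (p + 2) ^ 6 = ((p + 2) ^ 2) ^ 2 * (p + 2) ^ 2 := by ring
      _ = _ := by rw [q4, q2]; linear_combination 375 * hp
  have w10 : (p + 2) ^ 10 = 106250 + p * 171875 := by
    have q2 : (p + 2) ^ 2 = 5 + p * 5 := by linear_combination hp
    have q4 : ((p + 2) ^ 2) ^ 2 = 50 + p * 75 := by rw [q2]; linear_combination 25 * hp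
    calc (p + 2) ^ 10 = (p + 2) ^ 6 * ((p + 2) ^ 2) ^ 2 := by ring
      _ = _ := by rw [q4, w6]; linear_combination 75000 * hp
  have w15 : (p + 2) ^ 15 = 65859375 + p * 106562500 := by
    have q2 : (p + 2) ^ 2 = 5 + p * 5 := by linear_combination hp
    have q4 : ((p + 2) ^ 2) ^ 2 = 50 + p * 75 := by rw [q2]; linear_combination 25 * hp
    have q5 : ((p + 2) ^ 2) ^ 2 * (p + 2) = 175 + p * 275 := by rw [q4]; linear_combination 75 * hp
    calc (p + 2) ^ 15 = (p + 2) ^ 10 * (((p + 2) ^ 2) ^ 2 * (p + 2)) := by ring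
      _ = _ := by rw [q5, w10]; linear_combination (171875 * 275) * hp
  refine ⟨?_, ?_, ?_⟩
  · rw [w6]; linear_combination hD
  · rw [w10]; linear_combination hSX + hTZ
  · rw [w15]; linear_combination hUX + hVX

section helpers

variable {K : Type*} [Field K]

noncomputable def Tmap (ζ : K) : MvPolynomial (Fin 2) K →ₐ[K] MvPolynomial (Fin 2) K :=
  aeval ![C (ζ ^ 2) * X 0, C (ζ ^ 3) * X 1]

noncomputable def Mmap (φ κ : K) : MvPolynomial (Fin 2) K →ₐ[K] MvPolynomial (Fin 2) K :=
  aeval ![C κ⁻¹ * (C φ * X 0 + X 1), C κ⁻¹ * (X 0 - C φ * X 1)]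

noncomputable def InvAlg (ζ φ κ : K) : Subalgebra K (MvPolynomial (Fin 2) K) :=
  AlgHom.equalizer (Tmap ζ) (AlgHom.id K _) ⊓ AlgHom.equalizer (Mmap φ κ) (AlgHom.id K _)

lemma mem_InvAlg {ζ φ κ : K} {f : MvPolynomial (Fin 2) K} :
    f ∈ InvAlg ζ φ κ ↔ Tmap ζ f = f ∧ Mmap φ κ f = f := by
  simp [InvAlg, Algebra.mem_inf, AlgHom.mem_equalizer]

lemma T0 (ζ : K) : Tmap ζ (X 0) = C (ζ ^ 2) * X 0 := by simp [Tmap]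
lemma T1 (ζ : K) : Tmap ζ (X 1) = C (ζ ^ 3) * X 1 := by simp [Tmap]
lemma TC (ζ r : K) : Tmap ζ (C r) = C r := by simp [Tmap, algebraMap_eq]
lemma M0 (φ κ : K) : Mmap φ κ (X 0) = C κ⁻¹ * (C φ * X 0 + X 1) := by simp [Mmap]
lemma M1 (φ κ : K) : Mmap φ κ (X 1) = C κ⁻¹ * (X 0 - C φ * X 1) := by simp [Mmap]
lemma MC (φ κ r : K) : Mmap φ κ (C r) = C r := by simp [Mmap, algebraMap_eq]

lemma gens_inv {ζ φ κ : K} (h5 : ζ ^ 5 = 1) (hp : φ ^ 2 = φ + 1) (hk : κ ^ 2 = -(φ + 2))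
    (hk0 : κ ≠ 0) :
    Dpoly K ∈ InvAlg ζ φ κ ∧ c4poly K ∈ InvAlg ζ φ κ ∧ c6poly K ∈ InvAlg ζ φ κ := by
  have hz5 : (C ζ : MvPolynomial (Fin 2) K) ^ 5 = 1 := by rw [← C_pow, h5, C_1]
  have e0 : (C ζ ^ 2 * X 0 : MvPolynomial (Fin 2) K) ^ 5 = X 0 ^ 5 := by
    linear_combination X 0 ^ 5 * ((C ζ) ^ 5 + 1) * hz5
  have e1 : (C ζ ^ 3 * X 1 : MvPolynomial (Fin 2) K) ^ 5 = X 1 ^ 5 := by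
    linear_combination X 1 ^ 5 * ((C ζ) ^ 10 + (C ζ) ^ 5 + 1) * hz5
  have e2 : (C ζ ^ 2 * X 0 : MvPolynomial (Fin 2) K) * (C ζ ^ 3 * X 1) = X 0 * X 1 := by
    linear_combination X 0 * X 1 * hz5
  have hp' : (C φ : MvPolynomial (Fin 2) K) ^ 2 = C φ + 1 := by
    rw [← C_pow, hp, C_add, C_1]
  have hkk : (C κ⁻¹ : MvPolynomial (Fin 2) K) ^ 2 * (C φ + 2) = -1 := by
    have : κ⁻¹ ^ 2 * (φ + 2) = -1 := by
      have : φ + 2 = - κ ^ 2 := by rw [hk]; ring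
      rw [this]; field_simp
    have h := congrArg (C : K → MvPolynomial (Fin 2) K) this
    rw [C_mul, C_add, C_pow, C_neg, C_1] at h
    exact h
  obtain ⟨fD, f4, f6⟩ := forms_transform (C φ : MvPolynomial (Fin 2) K) (X 0) (X 1) _ _ hp' rfl rfl
  have k6 : (C κ⁻¹ : MvPolynomial (Fin 2) K) ^ 12 * (C φ + 2) ^ 6 = 1 := by
    calc _ = ((C κ⁻¹ : MvPolynomial (Fin 2) K) ^ 2 * (C φ + 2)) ^ 6 := by ring
      _ = 1 := by rw [hkk]; norm_num
  have k10 : (C κ⁻¹ : MvPolynomial (Fin 2) K) ^ 20 * (C φ + 2) ^ 10 = 1 := by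
    calc _ = ((C κ⁻¹ : MvPolynomial (Fin 2) K) ^ 2 * (C φ + 2)) ^ 10 := by ring
      _ = 1 := by rw [hkk]; norm_num
  have k15 : (C κ⁻¹ : MvPolynomial (Fin 2) K) ^ 30 * (C φ + 2) ^ 15 = -1 := by
    calc _ = ((C κ⁻¹ : MvPolynomial (Fin 2) K) ^ 2 * (C φ + 2)) ^ 15 := by ring
      _ = -1 := by rw [hkk]; norm_num
  set u := (C φ * X 0 + X 1 : MvPolynomial (Fin 2) K) with hu
  set v := (X 0 - C φ * X 1 : MvPolynomial (Fin 2) K) with hv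
  set k := (C κ⁻¹ : MvPolynomial (Fin 2) K) with hk'
  simp only [mem_InvAlg]
  refine ⟨⟨?_, ?_⟩, ⟨?_, ?_⟩, ⟨?_, ?_⟩⟩
  · simp only [Dpoly, map_mul, map_sub, map_pow, T0, T1, map_ofNat]
    generalize (C ζ ^ 2 * X 0 : MvPolynomial (Fin 2) K) = x at *
    generalize (C ζ ^ 3 * X 1 : MvPolynomial (Fin 2) K) = y at *
    rw [show x * y * (x ^ 10 - 11 * x ^ 5 * y ^ 5 - y ^ 10) =
      x * y * ((x ^ 5) ^ 2 - 11 * x ^ 5 * y ^ 5 - (y ^ 5) ^ 2) by ring, e0, e1, e2]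
    ring
  · simp only [Dpoly, map_mul, map_sub, map_pow, M0, M1, map_ofNat]
    rw [← hk', ← hu, ← hv]
    linear_combination k ^ 12 * fD + (X 0 * X 1 * (X 0 ^ 10 - 11 * X 0 ^ 5 * X 1 ^ 5 - X 1 ^ 10)) * k6
  · simp only [c4poly, map_mul, map_add, map_sub, map_pow, T0, T1, map_ofNat]
    generalize (C ζ ^ 2 * X 0 : MvPolynomial (Fin 2) K) = x at *
    generalize (C ζ ^ 3 * X 1 : MvPolynomial (Fin 2) K) = y at *
    rw [show x ^ 20 + 228 * x ^ 15 * y ^ 5 + 494 * x ^ 10 * y ^ 10 - 228 * x ^ 5 * y ^ 15 + y ^ 20 =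
      (x ^ 5) ^ 4 + 228 * (x ^ 5) ^ 3 * y ^ 5 + 494 * (x ^ 5) ^ 2 * (y ^ 5) ^ 2
        - 228 * x ^ 5 * (y ^ 5) ^ 3 + (y ^ 5) ^ 4 by ring, e0, e1]
    ring
  · simp only [c4poly, map_mul, map_add, map_sub, map_pow, M0, M1, map_ofNat]
    rw [← hk', ← hu, ← hv]
    linear_combination k ^ 20 * f4 + (X 0 ^ 20 + 228 * X 0 ^ 15 * X 1 ^ 5
      + 494 * X 0 ^ 10 * X 1 ^ 10 - 228 * X 0 ^ 5 * X 1 ^ 15 + X 1 ^ 20) * k10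
  · simp only [c6poly, map_mul, map_add, map_sub, map_neg, map_pow, T0, T1, map_ofNat]
    generalize (C ζ ^ 2 * X 0 : MvPolynomial (Fin 2) K) = x at *
    generalize (C ζ ^ 3 * X 1 : MvPolynomial (Fin 2) K) = y at *
    rw [show -(x ^ 30) + 522 * x ^ 25 * y ^ 5 + 10005 * x ^ 20 * y ^ 10
      + 10005 * x ^ 10 * y ^ 20 - 522 * x ^ 5 * y ^ 25 - y ^ 30 =
      -(x ^ 5) ^ 6 + 522 * (x ^ 5) ^ 5 * y ^ 5 + 10005 * (x ^ 5) ^ 4 * (y ^ 5) ^ 2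
      + 10005 * (x ^ 5) ^ 2 * (y ^ 5) ^ 4 - 522 * x ^ 5 * (y ^ 5) ^ 5 - (y ^ 5) ^ 6 by ring, e0, e1]
    ring
  · simp only [c6poly, map_mul, map_add, map_sub, map_neg, map_pow, M0, M1, map_ofNat]
    rw [← hk', ← hu, ← hv]
    linear_combination k ^ 30 * f6 - (-(X 0 ^ 30) + 522 * X 0 ^ 25 * X 1 ^ 5
      + 10005 * X 0 ^ 20 * X 1 ^ 10
      + 10005 * X 0 ^ 10 * X 1 ^ 20 - 522 * X 0 ^ 5 * X 1 ^ 25 - X 1 ^ 30) * k15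

/-! ### homogeneity -/

lemma aeval_scale {A : Type*} [CommRing A] [Algebra K A] {f : MvPolynomial (Fin 2) K} {d : ℕ}
    (hf : f.IsHomogeneous d) (t : A) (x : Fin 2 → A) :
    aeval (fun i => t * x i) f = t ^ d * aeval x f := by
  rw [aeval_def, aeval_def, eval₂_eq', eval₂_eq', Finset.mul_sum]
  refine Finset.sum_congr rfl fun m hm => ?_
  have h := hf.degree_eq_sum_deg_support hm
  have h' : d = m 0 + m 1 := by
    rw [h, ← Finsupp.degree_apply, Finsupp.degree_eq_sum, Fin.sum_univ_two]
  simp only [Fin.prod_univ_two]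
  rw [h']
  ring

lemma hom_D : (Dpoly K).IsHomogeneous 12 := by
  unfold Dpoly
  have x0 := isHomogeneous_X K (0 : Fin 2)
  have x1 := isHomogeneous_X K (1 : Fin 2)
  have h11 : (11 : MvPolynomial (Fin 2) K).IsHomogeneous 0 := 
    isHomogeneous_C (Fin 2) (11 : K)
  exact (x0.mul x1).mul (((x0.pow 10).sub ((h11.mul (x0.pow 5)).mul (x1.pow 5))).sub (x1.pow 10))

lemma hom_c4 : (c4poly K).IsHomogeneous 20 := by
  unfold c4poly
  have x0 := isHomogeneous_X K (0 : Fin 2)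
  have x1 := isHomogeneous_X K (1 : Fin 2)
  have h1 : (228 : MvPolynomial (Fin 2) K).IsHomogeneous 0 := 
    isHomogeneous_C (Fin 2) (228 : K)
  have h2 : (494 : MvPolynomial (Fin 2) K).IsHomogeneous 0 := 
    isHomogeneous_C (Fin 2) (494 : K)
  exact ((((x0.pow 20).add ((h1.mul (x0.pow 15)).mul (x1.pow 5))).add
    ((h2.mul (x0.pow 10)).mul (x1.pow 10))).sub ((h1.mul (x0.pow 5)).mul (x1.pow 15))).add
    (x1.pow 20)

lemma hom_c6 : (c6poly K).IsHomogeneous 30 := by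
  unfold c6poly
  have x0 := isHomogeneous_X K (0 : Fin 2)
  have x1 := isHomogeneous_X K (1 : Fin 2)
  have h1 : (522 : MvPolynomial (Fin 2) K).IsHomogeneous 0 := 
    isHomogeneous_C (Fin 2) (522 : K)
  have h2 : (10005 : MvPolynomial (Fin 2) K).IsHomogeneous 0 := 
    isHomogeneous_C (Fin 2) (10005 : K)
  exact (((((x0.pow 30).neg.add ((h1.mul (x0.pow 25)).mul (x1.pow 5))).add
    ((h2.mul (x0.pow 20)).mul (x1.pow 10))).add ((h2.mul (x0.pow 10)).mul (x1.pow 20))).sub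
    ((h1.mul (x0.pow 5)).mul (x1.pow 25))).sub (x1.pow 30)

lemma hom_T {ζ : K} {f : MvPolynomial (Fin 2) K} {d : ℕ} (hf : f.IsHomogeneous d) :
    (Tmap ζ f).IsHomogeneous d := by
  have : (Tmap ζ f).IsHomogeneous (1 * d) := hf.aeval (R := K) (S := K) (τ := Fin 2) (n := 1) ![C (ζ ^ 2) * X 0, C (ζ ^ 3) * X 1] (by
    intro i
    fin_cases i
    · exact isHomogeneous_C_mul_X _ _
    · exact isHomogeneous_C_mul_X _ _)
  rw [one_mul] at this
  exact this

lemma hom_M {φ κ : K} {f : MvPolynomial (Fin 2) K} {d : ℕ} (hf : f.IsHomogeneous d) :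
    (Mmap φ κ f).IsHomogeneous d := by
  have : (Mmap φ κ f).IsHomogeneous (1 * d) := hf.aeval (R := K) (S := K) (τ := Fin 2) (n := 1) ![C κ⁻¹ * (C φ * X 0 + X 1), C κ⁻¹ * (X 0 - C φ * X 1)] (by
    intro i
    fin_cases i
    · exact ((isHomogeneous_C_mul_X _ _).add (isHomogeneous_X _ _)).C_mul _
    · exact ((isHomogeneous_X _ _).sub (isHomogeneous_C_mul_X _ _)).C_mul _)
  rw [one_mul] at this
  exact this

lemma comp_comm (F : MvPolynomial (Fin 2) K →ₐ[K] MvPolynomial (Fin 2) K)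
    (hF : ∀ d f, IsHomogeneous f d → IsHomogeneous (F f) d) (f : MvPolynomial (Fin 2) K) (n : ℕ) :
    F (homogeneousComponent n f) = homogeneousComponent n (F f) := by
  conv_rhs => rw [← sum_homogeneousComponent f, map_sum, map_sum]
  have h : ∀ i, homogeneousComponent n (F (homogeneousComponent i f)) =
      if i = n then F (homogeneousComponent n f) else 0 := by
    intro i
    rw [homogeneousComponent_of_mem (n := i) (hF _ _ (homogeneousComponent_isHomogeneous i f))]
    split_ifs with h1 h2 h2
    · rw [h1]
    · exact absurd h1.symm h2
    · exact absurd h2.symm h1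
    · rfl
  simp only [h]
  rw [Finset.sum_ite_eq']
  split_ifs with h1
  · rfl
  · rw [homogeneousComponent_eq_zero, map_zero]
    simpa using h1

lemma comp_inv {ζ φ κ : K} {f : MvPolynomial (Fin 2) K} (hf : f ∈ InvAlg ζ φ κ) (n : ℕ) :
    homogeneousComponent n f ∈ InvAlg ζ φ κ := by
  rw [mem_InvAlg] at *
  exact ⟨by rw [comp_comm _ (fun _ _ => hom_T), hf.1], by rw [comp_comm _ (fun _ _ => hom_M), hf.2]⟩

lemma D_ne_zero [CharZero K] : Dpoly K ≠ 0 := by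
  intro h
  have := congrArg (eval ![1, 1]) h
  simp [Dpoly] at this

lemma hom_quot [CharZero K] {f g : MvPolynomial (Fin 2) K} {d : ℕ} (hf : f.IsHomogeneous d)
    (h : f = Dpoly K * g) : g.IsHomogeneous (d - 12) ∧ (d < 12 → g = 0) := by
  have key : f = ∑ i ∈ Finset.range (g.totalDegree + 1),
      if d = 12 + i then Dpoly K * homogeneousComponent i g else 0 := by
    conv_lhs => rw [← homogeneousComponent_eq_self hf, h, ← sum_homogeneousComponent g,
      Finset.mul_sum, map_sum]
    refine Finset.sum_congr rfl fun i _ => ?_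
    rw [homogeneousComponent_of_mem (n := 12 + i)
      (hom_D.mul (homogeneousComponent_isHomogeneous i g))]
  by_cases hd : d < 12
  · have : f = 0 := by
      rw [key]
      refine Finset.sum_eq_zero fun i _ => ?_
      rw [if_neg (by omega)]
    have hg : g = 0 := by
      rw [h] at this
      exact (mul_eq_zero.mp this).resolve_left D_ne_zero
    exact ⟨by rw [hg]; exact isHomogeneous_zero _ _ _, fun _ => hg⟩
  · refine ⟨?_, fun h => absurd h hd⟩
    have hg : g = homogeneousComponent (d - 12) g := by
      apply mul_left_cancel₀ D_ne_zero
      rw [← h, key]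
      by_cases hm : d - 12 ∈ Finset.range (g.totalDegree + 1)
      · rw [Finset.sum_eq_single_of_mem _ hm]
        · rw [if_pos (by omega)]
        · intro j _ hj
          rw [if_neg (by omega)]
      · rw [homogeneousComponent_eq_zero, mul_zero]
        · refine Finset.sum_eq_zero fun i hi => ?_
          rw [if_neg]
          rintro rfl
          exact hm (by simpa using hi)
        · simp at hm; omega
    rw [hg]
    exact homogeneousComponent_isHomogeneous _ _

lemma X1_dvd {f : MvPolynomial (Fin 2) K} {d : ℕ} (hf : f.IsHomogeneous d)
    (h : eval ![1, 0] f = 0) : X 1 ∣ f := by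
  have h0 : aeval (![X 0, 0] : Fin 2 → MvPolynomial (Fin 2) K) f = 0 := by
    have h1 := aeval_scale hf (X 0 : MvPolynomial (Fin 2) K) ![1, 0]
    have h2 : (fun i => X 0 * (![1, 0] : Fin 2 → MvPolynomial (Fin 2) K) i) = ![X 0, 0] := by
      ext1 i; fin_cases i <;> simp
    have h3 : aeval (![1, 0] : Fin 2 → MvPolynomial (Fin 2) K) f = C (eval ![1, 0] f) := by
      have : (aeval (![1, 0] : Fin 2 → MvPolynomial (Fin 2) K)) =
          (Algebra.ofId K (MvPolynomial (Fin 2) K)).comp (aeval (![1, 0] : Fin 2 → K)) := by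
        apply MvPolynomial.algHom_ext
        intro i; fin_cases i <;> simp
      rw [this, AlgHom.comp_apply, aeval_eq_eval]
      rfl
    rw [h2, h3, h] at h1
    simpa using h1
  rw [← Ideal.mem_span_singleton, ← Ideal.Quotient.eq_zero_iff_mem]
  set I : Ideal (MvPolynomial (Fin 2) K) := Ideal.span {X 1}
  have : (Ideal.Quotient.mkₐ K I) = (Ideal.Quotient.mkₐ K I).comp
      (aeval (![X 0, 0] : Fin 2 → MvPolynomial (Fin 2) K)) := by
    apply MvPolynomial.algHom_ext
    intro i; fin_cases i
    · simp
    · simp [I]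
  have h4 := DFunLike.congr_fun this f
  rw [AlgHom.comp_apply, h0, map_zero] at h4
  exact h4

/-! ### Divisibility by `D` -/

lemma relprime_lin {r s : K} (hrs : r ≠ s) {x y : MvPolynomial (Fin 2) K} (h : IsRelPrime x y) :
    IsRelPrime (x - C r * y) (x - C s * y) := by
  intro d h1 h2
  have hu : (C (s - r)⁻¹ : MvPolynomial (Fin 2) K) * (C s - C r) = 1 := by
    rw [← C_sub, ← C_mul, inv_mul_cancel₀ (sub_ne_zero.mpr hrs.symm), C_1]
  have hy : d ∣ y := by
    have := (dvd_sub h1 h2).mul_left (C (s - r)⁻¹)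
    convert this using 1
    linear_combination -y * hu
  have hx : d ∣ x := by
    have := dvd_add h1 (hy.mul_left (C r))
    simpa using this
  exact h hx hy

lemma relprime_X : IsRelPrime (X 0 : MvPolynomial (Fin 2) K) (X 1) := by
  rw [(X_prime (R := K) (i := (0 : Fin 2))).irreducible.isRelPrime_iff_not_dvd]
  rw [X_dvd_X]
  simp

lemma five_dvd {ζ : K} (hζ : IsPrimitiveRoot ζ 5) (hs : ζ ^ 4 + ζ ^ 3 + ζ ^ 2 + ζ + 1 = 0)
    {r : K} (hr : r ≠ 0) {f : MvPolynomial (Fin 2) K}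
    (h : ∀ k : ℕ, X 0 - C (r * ζ ^ k) * X 1 ∣ f) : X 0 ^ 5 - C (r ^ 5) * X 1 ^ 5 ∣ f := by
  have h1 := Fintype.prod_dvd_of_isRelPrime
    (s := fun k : Fin 5 => (X 0 - C (r * ζ ^ (k : ℕ)) * X 1 : MvPolynomial (Fin 2) K)) (z := f)
    (by
      intro i j hij
      refine relprime_lin ?_ relprime_X
      intro he
      exact hij (Fin.ext (hζ.pow_inj i.2 j.2 (mul_left_cancel₀ hr he))))
    (fun i => h i)
  convert h1 using 1
  rw [Fin.prod_univ_five]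
  have hs' : (C ζ : MvPolynomial (Fin 2) K) ^ 4 + C ζ ^ 3 + C ζ ^ 2 + C ζ + 1 = 0 := by
    simp only [← C_pow, ← C_add, ← C_1 (σ := Fin 2) (R := K)]
    rw [hs, C_0]
  simp only [C_mul, C_pow]
  generalize (C ζ : MvPolynomial (Fin 2) K) = z at *
  generalize (C r : MvPolynomial (Fin 2) K) = q at *
  generalize (X 0 : MvPolynomial (Fin 2) K) = x at *
  have h5 : z ^ 5 = 1 := by linear_combination (z - 1) * hs'
  simp only [Fin.val_zero, Fin.val_one, Fin.val_two,
    show ((3 : Fin 5) : ℕ) = 3 from rfl, show ((4 : Fin 5) : ℕ) = 4 from rfl]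
  generalize hy : q * (X 1 : MvPolynomial (Fin 2) K) = y
  have a1 : (x - z * y) * (x - z ^ 4 * y) = x ^ 2 - (z + z ^ 4) * x * y + y ^ 2 := by
    linear_combination y ^ 2 * h5
  have a2 : (x - z ^ 2 * y) * (x - z ^ 3 * y) = x ^ 2 + (1 + z + z ^ 4) * x * y + y ^ 2 := by
    linear_combination y ^ 2 * h5 - x * y * hs'
  have a3 : (z + z ^ 4) * (1 + z + z ^ 4) = 1 := by
    linear_combination hs' + (2 + z ^ 3) * h5
  have a4 : (x - q * z ^ 0 * X 1) * (x - q * z ^ 1 * X 1) * (x - q * z ^ 2 * X 1)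
      * (x - q * z ^ 3 * X 1) * (x - q * z ^ 4 * X 1) = (x - y) *
      ((x - z * y) * (x - z ^ 4 * y)) * ((x - z ^ 2 * y) * (x - z ^ 3 * y)) := by
    rw [← hy]; ring
  rw [a4, a1, a2]
  have a5 : q ^ 5 * (X 1 : MvPolynomial (Fin 2) K) ^ 5 = y ^ 5 := by rw [← hy]; ring
  rw [a5]
  linear_combination (x - y) * x ^ 2 * y ^ 2 * a3

lemma D_dvd [CharZero K] {ζ φ κ : K} (hζ : IsPrimitiveRoot ζ 5)
    (hs : ζ ^ 4 + ζ ^ 3 + ζ ^ 2 + ζ + 1 = 0)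
    (hφ : φ = 1 + ζ + ζ ^ 4) (hp : φ ^ 2 = φ + 1)
    {f : MvPolynomial (Fin 2) K} (hf : f ∈ InvAlg ζ φ κ) (h : X 1 ∣ f) : Dpoly K ∣ f := by
  rw [mem_InvAlg] at hf
  obtain ⟨hT, hM⟩ := hf
  have T' : ∀ g, g ∣ f → Tmap ζ g ∣ f := fun g hg => by
    have := map_dvd (Tmap ζ) hg
    rwa [hT] at this
  have M' : ∀ g, g ∣ f → Mmap φ κ g ∣ f := fun g hg => by
    have := map_dvd (Mmap φ κ) hg
    rwa [hM] at this
  have Tk : ∀ r, X 0 - C r * X 1 ∣ f → ∀ k : ℕ, X 0 - C (r * ζ ^ k) * X 1 ∣ f := by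
    intro r hr k
    induction k with
    | zero => simpa using hr
    | succ k ih =>
      have := T' _ ih
      rw [map_sub, map_mul, T0, T1, TC] at this
      refine dvd_of_mul_left_dvd (a := C (ζ ^ 2)) ?_
      convert this using 1
      simp only [C_mul, C_pow]
      ring
  have hA : ∀ k : ℕ, X 0 - C (φ * ζ ^ k) * X 1 ∣ f := by
    apply Tk
    have := M' _ h
    rw [M1] at this
    exact dvd_of_mul_left_dvd this
  have hB : ∀ k : ℕ, X 0 - C ((1 - φ) * ζ ^ k) * X 1 ∣ f := by
    have h2 : X 0 - C ((1 - φ) * ζ ^ 2) * X 1 ∣ f := by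
      have := M' _ (hA 2)
      rw [map_sub, map_mul, M0, M1, MC] at this
      refine dvd_of_mul_left_dvd (a := C (κ⁻¹ * (φ * (1 - ζ ^ 2)))) ?_
      convert this using 1
      have e : φ * (1 - ζ ^ 2) * (1 - φ) * ζ ^ 2 = -(1 + φ ^ 2 * ζ ^ 2) := by
        have h5 : ζ ^ 5 = 1 := hζ.pow_eq_one
        have e1 : 1 + φ ^ 2 * ζ ^ 2 = ζ ^ 2 * (1 - ζ ^ 2) := by
          rw [hp, hφ]
          linear_combination hs + ζ * h5
        rw [e1]
        linear_combination (-(1 - ζ ^ 2) * ζ ^ 2) * hp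
      have e' := congrArg (C : K → MvPolynomial (Fin 2) K) e
      simp only [C_mul, C_pow, C_sub, C_add, C_neg, C_1] at e' ⊢
      linear_combination (-C κ⁻¹ * X 1) * e'
    intro k
    have h3 := Tk _ h2 (k + 3)
    have e : (1 - φ) * ζ ^ 2 * ζ ^ (k + 3) = (1 - φ) * ζ ^ k := by
      linear_combination (1 - φ) * ζ ^ k * hζ.pow_eq_one
    rwa [e] at h3
  have h0 : X 0 ∣ f := by
    have := M' _ (hB 0)
    rw [map_sub, map_mul, M0, M1, MC] at this
    refine dvd_of_mul_left_dvd (a := C (κ⁻¹ * (2 * φ - 1))) ?_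
    convert this using 1
    have e' := congrArg (C : K → MvPolynomial (Fin 2) K) hp
    have e2 : (C 2 : MvPolynomial (Fin 2) K) = 2 := rfl
    simp only [C_mul, C_pow, C_sub, C_add, C_1, pow_zero, mul_one, e2] at e' ⊢
    linear_combination (C κ⁻¹ * X 1) * e'
  have hφ0 : φ ≠ 0 := by rintro rfl; norm_num at hp
  have hφ1 : 1 - φ ≠ 0 := by
    intro h
    have : φ = 1 := by linear_combination -h
    rw [this] at hp; norm_num at hp
  have p5 : φ ^ 5 = 5 * φ + 3 := by
    linear_combination (φ ^ 3 + φ ^ 2 + 2 * φ + 3) * hp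
  have q5 : (1 - φ) ^ 5 = 8 - 5 * φ := by
    linear_combination (-φ ^ 3 + 4 * φ ^ 2 - 7 * φ + 7) * hp
  have hne : φ ^ 5 ≠ (1 - φ) ^ 5 := by
    rw [p5, q5]
    intro h
    have h' : φ = 1 / 2 := by linear_combination h / 10
    rw [h'] at hp; norm_num at hp
  have hA' := five_dvd hζ hs hφ0 hA
  have hB' := five_dvd hζ hs hφ1 hB
  have r55 : IsRelPrime (X 0 ^ 5 : MvPolynomial (Fin 2) K) (X 1 ^ 5) := relprime_X.pow
  have hAB := (relprime_lin hne r55).mul_dvd hA' hB'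
  have h01 := relprime_X.mul_dvd h0 h
  have hD : Dpoly K = (X 0 * X 1) *
      ((X 0 ^ 5 - C (φ ^ 5) * X 1 ^ 5) * (X 0 ^ 5 - C ((1 - φ) ^ 5) * X 1 ^ 5)) := by
    have e1 : (C (φ ^ 5) : MvPolynomial (Fin 2) K) + C ((1 - φ) ^ 5) = 11 := by
      rw [← C_add, p5, q5]
      ring_nf
      rfl
    have e2 : (C (φ ^ 5) : MvPolynomial (Fin 2) K) * C ((1 - φ) ^ 5) = -1 := by
      rw [← C_mul, ← mul_pow, show φ * (1 - φ) = -1 by linear_combination -hp]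
      norm_num
    unfold Dpoly
    linear_combination X 0 * X 1 * (X 0 ^ 5 * X 1 ^ 5 * e1 - X 1 ^ 10 * e2)
  rw [hD]
  refine IsRelPrime.mul_dvd ?_ h01 hAB
  have r0 : ∀ r : K, r ≠ 0 → IsRelPrime (X 0 * X 1 : MvPolynomial (Fin 2) K)
      (X 0 ^ 5 - C r * X 1 ^ 5) := by
    intro r hr
    apply IsRelPrime.mul_left
    · have := (relprime_lin hr.symm r55)
      rw [C_0, zero_mul, sub_zero] at this
      exact this.of_dvd_left (dvd_pow_self _ (by norm_num))
    · intro d h1 h2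
      have h3 : d ∣ X 0 ^ 5 := by
        have := dvd_add h2 ((h1.trans (dvd_pow_self (X 1) (n := 5) (by norm_num))).mul_left (C r))
        simpa using this
      exact r55 h3 (h1.trans (dvd_pow_self (X 1) (n := 5) (by norm_num)))
  exact (r0 _ (pow_ne_zero _ hφ0)).mul_right (r0 _ (pow_ne_zero _ hφ1))

lemma div_D [CharZero K] {ζ φ κ : K} (hζ : IsPrimitiveRoot ζ 5)
    (hs : ζ ^ 4 + ζ ^ 3 + ζ ^ 2 + ζ + 1 = 0)
    (hφ : φ = 1 + ζ + ζ ^ 4) (hp : φ ^ 2 = φ + 1) (hk : κ ^ 2 = -(φ + 2)) (hk0 : κ ≠ 0)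
    {f : MvPolynomial (Fin 2) K} {d : ℕ} (hf : f ∈ InvAlg ζ φ κ) (hd : f.IsHomogeneous d)
    (h0 : eval ![1, 0] f = 0) :
    ∃ g ∈ InvAlg ζ φ κ, f = Dpoly K * g ∧ g.IsHomogeneous (d - 12) ∧ (d < 12 → g = 0) := by
  obtain ⟨g, hg⟩ := D_dvd hζ hs hφ hp hf (X1_dvd hd h0)
  refine ⟨g, ?_, hg, hom_quot hd hg⟩
  have hD := (gens_inv hζ.pow_eq_one hp hk hk0).1
  rw [mem_InvAlg] at *
  constructor
  · have := hf.1
    rw [hg, map_mul, hD.1] at this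
    exact mul_left_cancel₀ D_ne_zero this
  · have := hf.2
    rw [hg, map_mul, hD.2] at this
    exact mul_left_cancel₀ D_ne_zero this

lemma ten_dvd [CharZero K] {ζ φ κ : K} (hζ : IsPrimitiveRoot ζ 5)
    (hp : φ ^ 2 = φ + 1) (hk : κ ^ 2 = -(φ + 2)) (hk0 : κ ≠ 0)
    {f : MvPolynomial (Fin 2) K} {d : ℕ} (hf : f ∈ InvAlg ζ φ κ) (hd : f.IsHomogeneous d)
    (h0 : eval ![1, 0] f ≠ 0) : 10 ∣ d := by
  rw [mem_InvAlg] at hf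
  have h5 : 5 ∣ d := by
    have hc : (aeval (![1, 0] : Fin 2 → K)).comp (Tmap ζ) =
        aeval (fun i => ζ ^ 2 * (![1, 0] : Fin 2 → K) i) := by
      apply MvPolynomial.algHom_ext
      intro i
      fin_cases i <;> simp [Tmap]
    have h1 := DFunLike.congr_fun hc f
    rw [AlgHom.comp_apply, hf.1, aeval_scale hd, aeval_eq_eval] at h1
    have h2 : ζ ^ (2 * d) = 1 := by
      rw [pow_mul]
      exact mul_right_cancel₀ h0 (by rw [← h1, one_mul])
    have h3 := hζ.dvd_of_pow_eq_one _ h2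
    omega
  have h2 : 2 ∣ d := by
    have hc : (Mmap φ κ).comp (Mmap φ κ) =
        aeval (fun i => (-1) * (X i : MvPolynomial (Fin 2) K)) := by
      have e : κ⁻¹ ^ 2 * (φ ^ 2 + 1) = -1 := by
        have : φ ^ 2 + 1 = - κ ^ 2 := by rw [hk, hp]; ring
        rw [this]; field_simp
      have e' := congrArg (C : K → MvPolynomial (Fin 2) K) e
      rw [C_mul, C_add, C_pow, C_pow, C_neg, C_1] at e'
      apply MvPolynomial.algHom_ext
      intro i
      rw [AlgHom.comp_apply, aeval_X]
      fin_cases i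
      · change Mmap φ κ (Mmap φ κ (X 0)) = -1 * X 0
        rw [M0, map_mul, map_add, map_mul, M0, M1, MC, MC]
        linear_combination X 0 * e'
      · change Mmap φ κ (Mmap φ κ (X 1)) = -1 * X 1
        rw [M1, map_mul, map_sub, map_mul, M0, M1, MC, MC]
        linear_combination X 1 * e'
    have h1 := DFunLike.congr_fun hc f
    rw [AlgHom.comp_apply, hf.2, hf.2, aeval_scale hd, aeval_X_left_apply] at h1
    have hf0 : f ≠ 0 := by rintro rfl; simp at h0
    have h2 : (-1 : MvPolynomial (Fin 2) K) ^ d = 1 :=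
      mul_right_cancel₀ hf0 (by rw [← h1, one_mul])
    exact even_iff_two_dvd.mp ((neg_one_pow_eq_one_iff_even (by norm_num)).mp h2)
  omega

lemma no_ten [CharZero K] {ζ φ κ : K} (hζ : IsPrimitiveRoot ζ 5)
    (hs : ζ ^ 4 + ζ ^ 3 + ζ ^ 2 + ζ + 1 = 0)
    (hφ : φ = 1 + ζ + ζ ^ 4) (hp : φ ^ 2 = φ + 1) (hk : κ ^ 2 = -(φ + 2)) (hk0 : κ ≠ 0)
    {f : MvPolynomial (Fin 2) K} (hf : f ∈ InvAlg ζ φ κ) (hd : f.IsHomogeneous 10) :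
    eval ![1, 0] f = 0 := by
  by_contra h0
  set α := eval ![1, 0] f with hα
  obtain ⟨-, i4, i6⟩ := gens_inv hζ.pow_eq_one hp hk hk0
  have hC : ∀ r : K, (C r : MvPolynomial (Fin 2) K) ∈ InvAlg ζ φ κ := fun r =>
    (InvAlg ζ φ κ).algebraMap_mem r
  have s2 : f ^ 2 = C (α ^ 2) * c4poly K := by
    have m1 : f ^ 2 - C (α ^ 2) * c4poly K ∈ InvAlg ζ φ κ :=
      sub_mem (pow_mem hf 2) (mul_mem (hC _) i4)
    have d1 : (f ^ 2 - C (α ^ 2) * c4poly K).IsHomogeneous 20 :=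
      (hd.pow 2).sub (hom_c4.C_mul _)
    obtain ⟨g, hg, e, dg, -⟩ := div_D hζ hs hφ hp hk hk0 m1 d1 (by simp [c4poly, ← hα])
    have g0 : eval ![1, 0] g = 0 := by
      by_contra hne
      have := ten_dvd hζ hp hk hk0 hg dg hne
      omega
    obtain ⟨g', -, e', -, z⟩ := div_D hζ hs hφ hp hk hk0 hg dg g0
    rw [e', z (by norm_num), mul_zero, mul_zero] at e
    exact sub_eq_zero.mp e
  have s3 : f ^ 3 = C (-α ^ 3) * c6poly K := by
    have m1 : f ^ 3 - C (-α ^ 3) * c6poly K ∈ InvAlg ζ φ κ :=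
      sub_mem (pow_mem hf 3) (mul_mem (hC _) i6)
    have d1 : (f ^ 3 - C (-α ^ 3) * c6poly K).IsHomogeneous 30 :=
      (hd.pow 3).sub (hom_c6.C_mul _)
    obtain ⟨g, hg, e, dg, -⟩ := div_D hζ hs hφ hp hk hk0 m1 d1 (by simp [c6poly, ← hα])
    have g0 : eval ![1, 0] g = 0 := by
      by_contra hne
      have := ten_dvd hζ hp hk hk0 hg dg hne
      omega
    obtain ⟨g', hg', e', dg', -⟩ := div_D hζ hs hφ hp hk hk0 hg dg g0
    have g0' : eval ![1, 0] g' = 0 := by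
      by_contra hne
      have := ten_dvd hζ hp hk hk0 hg' dg' hne
      omega
    obtain ⟨g'', -, e'', -, z⟩ := div_D hζ hs hφ hp hk hk0 hg' dg' g0'
    rw [e', e'', z (by norm_num), mul_zero, mul_zero, mul_zero] at e
    exact sub_eq_zero.mp e
  have t2 := congrArg (eval ![1, 1]) s2
  have t3 := congrArg (eval ![1, 1]) s3
  have v4 : eval ![1, 1] (c4poly K) = 496 := by
    simp [c4poly]; norm_num
  have v6 : eval ![1, 1] (c6poly K) = 20008 := by
    simp [c6poly]; norm_num
  rw [map_pow, map_mul, v4, eval_C] at t2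
  rw [map_pow, map_mul, v6, eval_C] at t3
  generalize eval ![1, 1] f = w at t2 t3
  have h6 : α ^ 6 * (496 ^ 3 - 20008 ^ 2) = 0 := by
    have a1 : (w ^ 2) ^ 3 = (w ^ 3) ^ 2 := by ring
    rw [t2, t3] at a1
    linear_combination a1
  have : α ^ 6 ≠ 0 := pow_ne_zero _ h0
  rcases mul_eq_zero.mp h6 with h | h
  · exact this h
  · norm_num at h

lemma hom_mem [CharZero K] {ζ φ κ : K} (hζ : IsPrimitiveRoot ζ 5)
    (hs : ζ ^ 4 + ζ ^ 3 + ζ ^ 2 + ζ + 1 = 0)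
    (hφ : φ = 1 + ζ + ζ ^ 4) (hp : φ ^ 2 = φ + 1) (hk : κ ^ 2 = -(φ + 2)) (hk0 : κ ≠ 0)
    (d : ℕ) : ∀ f : MvPolynomial (Fin 2) K, f ∈ InvAlg ζ φ κ → f.IsHomogeneous d →
      f ∈ Algebra.adjoin K ({Dpoly K, c4poly K, c6poly K} : Set (MvPolynomial (Fin 2) K)) := by
  induction d using Nat.strong_induction_on with
  | _ d ih =>
  obtain ⟨-, i4, i6⟩ := gens_inv hζ.pow_eq_one hp hk hk0
  have aD : Dpoly K ∈ Algebra.adjoin K ({Dpoly K, c4poly K, c6poly K} :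
    Set (MvPolynomial (Fin 2) K)) := Algebra.subset_adjoin (by simp)
  have a4 : c4poly K ∈ Algebra.adjoin K ({Dpoly K, c4poly K, c6poly K} :
    Set (MvPolynomial (Fin 2) K)) := Algebra.subset_adjoin (by simp)
  have a6 : c6poly K ∈ Algebra.adjoin K ({Dpoly K, c4poly K, c6poly K} :
    Set (MvPolynomial (Fin 2) K)) := Algebra.subset_adjoin (by simp)
  set A := Algebra.adjoin K ({Dpoly K, c4poly K, c6poly K} : Set (MvPolynomial (Fin 2) K))
  have hC : ∀ r : K, (C r : MvPolynomial (Fin 2) K) ∈ InvAlg ζ φ κ := fun r =>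
    (InvAlg ζ φ κ).algebraMap_mem r
  have hCA : ∀ r : K, (C r : MvPolynomial (Fin 2) K) ∈ A := fun r => A.algebraMap_mem r
  have case0 : ∀ f : MvPolynomial (Fin 2) K, f ∈ InvAlg ζ φ κ → f.IsHomogeneous d →
      eval ![1, 0] f = 0 → f ∈ A := by
    intro f hf hd h0
    obtain ⟨g, hg, e, dg, z⟩ := div_D hζ hs hφ hp hk hk0 hf hd h0
    by_cases h12 : d < 12
    · rw [e, z h12, mul_zero]
      exact zero_mem _
    · rw [e]
      exact mul_mem aD (ih _ (by omega) g hg dg)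
  intro f hf hd
  by_cases h0 : eval ![1, 0] f = 0
  · exact case0 f hf hd h0
  obtain ⟨m, rfl⟩ := ten_dvd hζ hp hk hk0 hf hd h0
  have hm1 : m ≠ 1 := by
    rintro rfl
    exact h0 (no_ten hζ hs hφ hp hk hk0 hf hd)
  obtain ⟨i, j, hij⟩ : ∃ i j : ℕ, m = 2 * i + 3 * j := by
    rcases Nat.even_or_odd' m with ⟨n, rfl | rfl⟩
    · exact ⟨n, 0, by omega⟩
    · exact ⟨n - 1, 1, by omega⟩
  set q := C (eval ![1, 0] f * (-1) ^ j) * (c4poly K ^ i * c6poly K ^ j) with hq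
  have hqA : q ∈ A := mul_mem (hCA _) (mul_mem (pow_mem a4 _) (pow_mem a6 _))
  have hqI : q ∈ InvAlg ζ φ κ := mul_mem (hC _) (mul_mem (pow_mem i4 _) (pow_mem i6 _))
  have hqd : q.IsHomogeneous (10 * m) := by
    have := ((hom_c4 (K := K)).pow i).mul ((hom_c6 (K := K)).pow j)
    rw [show 20 * i + 30 * j = 10 * m by omega] at this
    exact this.C_mul _
  have hq0 : eval ![1, 0] q = eval ![1, 0] f := by
    have v4 : eval ![1, 0] (c4poly K) = 1 := by simp [c4poly]
    have v6 : eval ![1, 0] (c6poly K) = -1 := by simp [c6poly]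
    rw [hq, eval_mul, eval_mul, eval_pow, eval_pow, v4, v6, eval_C, one_pow, one_mul, mul_assoc,
      ← mul_pow]
    norm_num
  have := case0 (f - q) (sub_mem hf hqI) (hd.sub hqd) (by rw [map_sub, hq0, sub_self])
  have h2 := add_mem this hqA
  rwa [sub_add_cancel] at h2

end helpers

/-- The polynomials invariant under both `(a,b) ↦ (ζ²a, ζ³b)` and
`(a,b) ↦ ((φa + b)/κ, (a - φb)/κ)` are exactly the `K`-subalgebra generated
by `D`, `c4` and `c6`. -/
theorem ring_of_discrete_invariants
    (K : Type*) [Field K] [CharZero K] (ζ φ κ : K)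
    (hζ : IsPrimitiveRoot ζ 5) (hφ : φ = 1 + ζ + ζ ^ 4) (hκ : κ = ζ ^ 4 - ζ) :
    {f : MvPolynomial (Fin 2) K |
        aeval ![C (ζ ^ 2) * X 0, C (ζ ^ 3) * X 1] f = f ∧
        aeval ![C κ⁻¹ * (C φ * X 0 + X 1), C κ⁻¹ * (X 0 - C φ * X 1)] f = f} =
      ↑(Algebra.adjoin K ({Dpoly K, c4poly K, c6poly K} :
          Set (MvPolynomial (Fin 2) K))) := by
  have h5 : ζ ^ 5 = 1 := hζ.pow_eq_one
  have hs : ζ ^ 4 + ζ ^ 3 + ζ ^ 2 + ζ + 1 = 0 := by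
    have h1 : ζ - 1 ≠ 0 := sub_ne_zero.mpr (hζ.ne_one (by norm_num))
    apply mul_left_cancel₀ h1
    linear_combination h5
  have hp : φ ^ 2 = φ + 1 := by
    rw [hφ]
    linear_combination hs + (ζ ^ 3 + 2) * h5
  have hk : κ ^ 2 = -(φ + 2) := by
    rw [hφ, hκ]
    linear_combination hs + (ζ ^ 3 - 2) * h5
  have hk0 : κ ≠ 0 := by
    intro h
    rw [h] at hk
    have h2 : φ = -2 := by linear_combination hk
    rw [h2] at hp
    norm_num at hp
  have hset : {f : MvPolynomial (Fin 2) K |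
        aeval ![C (ζ ^ 2) * X 0, C (ζ ^ 3) * X 1] f = f ∧
        aeval ![C κ⁻¹ * (C φ * X 0 + X 1), C κ⁻¹ * (X 0 - C φ * X 1)] f = f} =
      (InvAlg ζ φ κ : Set (MvPolynomial (Fin 2) K)) := by
    ext f
    rw [SetLike.mem_coe, mem_InvAlg]
    rfl
  rw [hset]
  apply Set.Subset.antisymm
  · intro f hf
    rw [SetLike.mem_coe] at hf ⊢
    rw [← sum_homogeneousComponent f]
    exact sum_mem fun i _ => hom_mem hζ hs hφ hp hk hk0 i _ (comp_inv hf i)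
      (homogeneousComponent_isHomogeneous i f)
  · obtain ⟨iD, i4, i6⟩ := gens_inv h5 hp hk hk0
    have : Algebra.adjoin K ({Dpoly K, c4poly K, c6poly K} : Set (MvPolynomial (Fin 2) K)) ≤
        InvAlg ζ φ κ := by
      rw [Algebra.adjoin_le_iff]
      rintro x (rfl | rfl | rfl)
      · exact iD
      · exact i4
      · exact i6
    exact this
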